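/- arXiv:1609.08679 — 4 statements merged into one kernel-verified Lean document; each statement's English description precedes it below -/
import Mathlib

section
/- Let p ≥ 3 be a natural number and define F₁₁, F₁₂ as in the context. Then for every real t ≥ 0, (3/50)·∑_{m,l ≥ 1, m+l < p} F₁₂(m, p+l; t) + ∑_{a=2}^∞ ∑_{m,l ≥ 1, m+l < p} F₁₁(m, ap+l; t) > 0, where the inner sums run over pairs of positive integers (m,l) with m + l < p. -/
noncomputable def c (p k : ℕ) : ℝ :=
  if k = p then 1 / (p : ℝ)
  else (2 * (p : ℝ)^2 * Real.sin (Real.pi * k / p)) /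
       (Real.pi * (k : ℝ) * ((p : ℝ)^2 - (k : ℝ)^2))

noncomputable def d (p k : ℕ) : ℝ :=
  if k = p ∨ k = 2 * p then 1 / (p : ℝ)
  else (6 * (p : ℝ)^2 * (k : ℝ) * Real.sin (Real.pi * k / p)) /
       (Real.pi * ((p : ℝ)^2 - (k : ℝ)^2) * (4 * (p : ℝ)^2 - (k : ℝ)^2))

noncomputable def F11 (p m l : ℕ) (t : ℝ) : ℝ :=
  c p m * d p l * c p (m + l) *
    Real.exp (-2 * ((m : ℝ)^2 + (l : ℝ)^2 + (m : ℝ) * (l : ℝ)) * t)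

noncomputable def F12 (p m l : ℕ) (t : ℝ) : ℝ :=
  c p m * c p l * d p (m + l) *
    Real.exp (-2 * ((m : ℝ)^2 + (l : ℝ)^2 + (m : ℝ) * (l : ℝ)) * t)

lemma c_eq_of_ne {p k : ℕ} (hp : 0 < p) (hk : k ≠ p) {u : ℝ} (hu : (k : ℝ) = u * p) :
    c p k = 2 / (Real.pi * p) * (Real.sin (u * Real.pi) / (u * (1 - u ^ 2))) := by
  have hp' : (p : ℝ) ≠ 0 := by positivity
  have harg : Real.pi * k / p = u * Real.pi := by rw [hu]; field_simp
  rw [c, if_neg hk, harg, hu,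
    show Real.pi * (u * p) * ((p : ℝ) ^ 2 - (u * p) ^ 2)
      = (p : ℝ) ^ 2 * (Real.pi * p * (u * (1 - u ^ 2))) by ring,
    show 2 * (p : ℝ) ^ 2 * Real.sin (u * Real.pi)
      = (p : ℝ) ^ 2 * (2 * Real.sin (u * Real.pi)) by ring,
    mul_div_mul_left _ _ (pow_ne_zero 2 hp'), mul_div_mul_comm]

lemma d_eq_of_ne {p k : ℕ} (hp : 0 < p) (hk : k ≠ p) (hk' : k ≠ 2 * p) {u : ℝ}
    (hu : (k : ℝ) = u * p) :
    d p k = 6 / (Real.pi * p) *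
      (u * Real.sin (u * Real.pi) / ((1 - u ^ 2) * (4 - u ^ 2))) := by
  have hp' : (p : ℝ) ≠ 0 := by positivity
  have harg : Real.pi * k / p = u * Real.pi := by rw [hu]; field_simp
  rw [d, if_neg (by tauto), harg, hu,
    show Real.pi * ((p : ℝ) ^ 2 - (u * p) ^ 2) * (4 * (p : ℝ) ^ 2 - (u * p) ^ 2)
      = (p : ℝ) ^ 3 * (Real.pi * p * ((1 - u ^ 2) * (4 - u ^ 2))) by ring,
    show 6 * (p : ℝ) ^ 2 * (u * p) * Real.sin (u * Real.pi)
      = (p : ℝ) ^ 3 * (6 * (u * Real.sin (u * Real.pi))) by ring,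
    mul_div_mul_left _ _ (pow_ne_zero 3 hp'), mul_div_mul_comm]

/-- The rational function through which `d` depends on `v = k / p` when `v > 2`. -/
noncomputable def dKernel (v : ℝ) : ℝ := v / ((v ^ 2 - 1) * (v ^ 2 - 4))

/-- The rational function through which `c` depends on `w = k / p` when `w > 1`. -/
noncomputable def cKernel (w : ℝ) : ℝ := 1 / (w * (w ^ 2 - 1))

lemma dKernel_nonneg {v : ℝ} (hv : 2 < v) : 0 ≤ dKernel v := by
  have h1 : 0 < v ^ 2 - 1 := by nlinarith
  have h2 : 0 < v ^ 2 - 4 := by nlinarith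
  unfold dKernel
  positivity

lemma cKernel_nonneg {w : ℝ} (hw : 1 < w) : 0 ≤ cKernel w := by
  have h1 : 0 < w ^ 2 - 1 := by nlinarith
  unfold cKernel
  positivity

lemma dKernel_le_dKernel {v v' : ℝ} (hv : 2 < v) (hvv' : v ≤ v') : dKernel v' ≤ dKernel v := by
  have h : ∀ u : ℝ, 2 < u → dKernel u = 1 / (u * (1 - 1 / u ^ 2) * (u ^ 2 - 4)) := by
    intro u hu
    have h0 : u ≠ 0 := by positivity
    unfold dKernel
    rw [show u * (1 - 1 / u ^ 2) * (u ^ 2 - 4) = ((u ^ 2 - 1) * (u ^ 2 - 4)) / u by field_simp,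
      one_div_div]
  have h1 : 1 / v' ^ 2 ≤ 1 / v ^ 2 := by gcongr
  have h2 : 1 / v ^ 2 < 1 := by
    rw [div_lt_one (by positivity)]
    nlinarith
  have h3 : 0 < 1 - 1 / v ^ 2 := by linarith
  have h4 : 0 < v ^ 2 - 4 := by nlinarith
  rw [h v hv, h v' (hv.trans_le hvv')]
  have h5 : 0 ≤ v' := by linarith
  have h6 : 0 ≤ v' * (1 - 1 / v' ^ 2) := mul_nonneg h5 (by linarith)
  gcongr

/-- A telescoping identity for `cKernel`. -/
lemma cKernel_eq_sub {w : ℝ} (hw : 1 < w) :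
    cKernel w = 1 / 2 * (1 / ((w - 1) * w)) - 1 / 2 * (1 / (w * (w + 1))) := by
  have h1 : w - 1 ≠ 0 := by linarith
  have h2 : w ≠ 0 := by linarith
  have h3 : w + 1 ≠ 0 := by linarith
  unfold cKernel
  rw [show w ^ 2 - 1 = (w - 1) * (w + 1) by ring]
  field_simp
  ring

lemma sum_dKernel_mul_cKernel_succ_le {y z : ℝ} (hy : 0 < y) (hz : 0 < z) (n : ℕ) :
    ∑ a ∈ Finset.range (n + 1), dKernel ((a + 2 : ℕ) + y) * cKernel ((a + 2 : ℕ) + z) ≤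
      dKernel (2 + y) * cKernel (2 + z) + dKernel (3 + y) * (1 / 2 * (1 / ((2 + z) * (3 + z))))
        - dKernel (3 + y) * (1 / 2 * (1 / ((n + 2 + z) * (n + 3 + z)))) := by
  induction n with
  | zero => simp
  | succ n ih =>
    rw [Finset.sum_range_succ]
    have hn : (0 : ℝ) ≤ n := n.cast_nonneg
    have h1 : dKernel ((n + 1 + 2 : ℕ) + y) ≤ dKernel (3 + y) :=
      dKernel_le_dKernel (by linarith) (by push_cast; linarith)
    have h2 := mul_le_mul_of_nonneg_right h1
      (cKernel_nonneg (w := (n + 1 + 2 : ℕ) + z) (by push_cast; linarith))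
    rw [cKernel_eq_sub (w := (n + 1 + 2 : ℕ) + z) (by push_cast; linarith)] at h2 ⊢
    have e1 : ((n + 1 + 2 : ℕ) : ℝ) + z - 1 = n + 2 + z := by push_cast; ring
    have e2 : ((n + 1 + 2 : ℕ) : ℝ) + z = n + 3 + z := by push_cast; ring
    have e3 : ((n + 1 : ℕ) : ℝ) + 2 + z = n + 3 + z := by push_cast; ring
    have e4 : ((n + 1 : ℕ) : ℝ) + 3 + z = n + 3 + z + 1 := by push_cast; ring
    rw [e1, e2] at h2 ⊢
    rw [e3, e4]
    linarith

lemma sum_dKernel_mul_cKernel_le {y z : ℝ} (hy : 0 < y) (hz : 0 < z) (n : ℕ) :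
    ∑ a ∈ Finset.range n, dKernel ((a + 2 : ℕ) + y) * cKernel ((a + 2 : ℕ) + z) ≤
      dKernel (2 + y) * cKernel (2 + z)
        + dKernel (3 + y) * (1 / 2 * (1 / ((2 + z) * (3 + z)))) := by
  have h3 : 0 ≤ dKernel (3 + y) := dKernel_nonneg (by linarith)
  cases n with
  | zero =>
    have := mul_nonneg (dKernel_nonneg (v := 2 + y) (by linarith))
      (cKernel_nonneg (w := 2 + z) (by linarith))
    rw [Finset.sum_range_zero]
    positivity
  | succ n =>
    refine (sum_dKernel_mul_cKernel_succ_le hy hz n).trans (sub_le_self _ ?_)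
    positivity

/-- The rational factor of `F12 p m (p + l)`, in terms of `y = l / p` and `z = (m + l) / p`. -/
noncomputable def mainKernel (y z : ℝ) : ℝ :=
  1 / (y * (1 + y) * (2 + y)) * ((1 + z) / (z * (2 + z) * (1 - z) * (3 + z)))

lemma kernel_bound {y z : ℝ} (hy : 0 < y) (hyz : y ≤ z) (hz : z < 1) :
    dKernel (2 + y) * cKernel (2 + z) + dKernel (3 + y) * (1 / 2 * (1 / ((2 + z) * (3 + z))))
      ≤ 11 / 200 * mainKernel y z := by
  have hz0 : 0 < z := hy.trans_le hyz
  have hz1 : 0 < 1 - z := by linarith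
  have hA : (2 + y) ^ 2 / ((3 + y) * (4 + y)) ≤ (2 + z) ^ 2 / ((3 + z) * (4 + z)) := by
    rw [div_le_div_iff₀ (by positivity) (by positivity)]
    have := mul_nonneg (sub_nonneg.2 hyz) (by positivity : 0 ≤ 20 + 8 * (y + z) + 3 * y * z)
    nlinarith
  have hB : (3 + y) ^ 2 * y / ((3 + y) * (4 + y) * (5 + y))
      ≤ (3 + z) ^ 2 * z / ((3 + z) * (4 + z) * (5 + z)) := by
    rw [show (3 + y) ^ 2 * y / ((3 + y) * (4 + y) * (5 + y))
        = (3 + y) / (4 + y) * (y / (5 + y)) by field_simp,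
      show (3 + z) ^ 2 * z / ((3 + z) * (4 + z) * (5 + z))
        = (3 + z) / (4 + z) * (z / (5 + z)) by field_simp]
    apply mul_le_mul _ _ (by positivity) (by positivity)
    · rw [div_le_div_iff₀ (by positivity) (by positivity)]; linarith
    · rw [div_le_div_iff₀ (by positivity) (by positivity)]; linarith
  have key : ((2 + z) ^ 2 / ((3 + z) * (4 + z)) * (1 / (1 + z))
      + (3 + z) ^ 2 * z / ((3 + z) * (4 + z) * (5 + z)) * (1 / 2))
        * (z * (1 - z) / (1 + z)) ≤ 11 / 200 := by
    rw [show ((2 + z) ^ 2 / ((3 + z) * (4 + z)) * (1 / (1 + z))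
      + (3 + z) ^ 2 * z / ((3 + z) * (4 + z) * (5 + z)) * (1 / 2))
        * (z * (1 - z) / (1 + z))
      = (2 * (2 + z) ^ 2 * (5 + z) + (3 + z) ^ 2 * z * (1 + z)) * (z * (1 - z))
        / (2 * (3 + z) * (4 + z) * (5 + z) * (1 + z) ^ 2) by field_simp,
      div_le_div_iff₀ (by positivity) (by positivity)]
    nlinarith [mul_nonneg hz0.le (sq_nonneg (5 * z - 2)), sq_nonneg (5 * z - 2),
      mul_nonneg (pow_nonneg hz0.le 2) (sq_nonneg (5 * z - 2)),
      mul_nonneg (pow_nonneg hz0.le 3) (sq_nonneg (5 * z - 2)),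
      mul_nonneg (pow_nonneg hz0.le 4) (sq_nonneg (5 * z - 2)),
      pow_pos hz0 2, pow_pos hz0 3, pow_pos hz0 4, pow_pos hz0 5]
  have hM : 0 ≤ mainKernel y z := by unfold mainKernel; positivity
  have hsplit : dKernel (2 + y) * cKernel (2 + z)
      + dKernel (3 + y) * (1 / 2 * (1 / ((2 + z) * (3 + z))))
      = ((2 + y) ^ 2 / ((3 + y) * (4 + y)) * (1 / (1 + z))
        + (3 + y) ^ 2 * y / ((3 + y) * (4 + y) * (5 + y)) * (1 / 2))
          * (z * (1 - z) / (1 + z)) * mainKernel y z := by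
    unfold dKernel cKernel mainKernel
    rw [show (2 + y) ^ 2 - 1 = (1 + y) * (3 + y) by ring,
      show (2 + y) ^ 2 - 4 = y * (4 + y) by ring,
      show (3 + y) ^ 2 - 1 = (2 + y) * (4 + y) by ring,
      show (3 + y) ^ 2 - 4 = (1 + y) * (5 + y) by ring,
      show (2 + z) ^ 2 - 1 = (1 + z) * (3 + z) by ring]
    field_simp
  rw [hsplit]
  refine mul_le_mul_of_nonneg_right (le_trans ?_ key) hM
  gcongr

/-- The factor common to all terms attached to the pair `(m, l)`. -/
noncomputable def commonFactor (p m l : ℕ) : ℝ :=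
  c p m * (12 / (Real.pi * p) ^ 2) *
    (Real.sin ((l / p : ℝ) * Real.pi) * Real.sin (((m + l) / p : ℝ) * Real.pi))

lemma commonFactor_pos {p m l : ℕ} (hm : 0 < m) (hl : 0 < l) (h : m + l < p) :
    0 < commonFactor p m l := by
  have hp : 0 < p := by omega
  have hp' : (0 : ℝ) < p := by exact_mod_cast hp
  have hm' : (0 : ℝ) < m := by exact_mod_cast hm
  have hl' : (0 : ℝ) < l := by exact_mod_cast hl
  have h' : (m : ℝ) + l < p := by exact_mod_cast h
  have hsin : ∀ u : ℝ, 0 < u → u < 1 → 0 < Real.sin (u * Real.pi) := fun u h0 h1 =>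
    Real.sin_pos_of_pos_of_lt_pi (by positivity) (by nlinarith [Real.pi_pos])
  have hx1 : (m : ℝ) / p < 1 := by rw [div_lt_one hp']; linarith
  have h1 := hsin (m / p) (by positivity) hx1
  have h2 := hsin (l / p) (by positivity) (by rw [div_lt_one hp']; linarith)
  have h3 := hsin ((m + l) / p) (by positivity) (by rw [div_lt_one hp']; linarith)
  have h4 : 0 < 1 - ((m : ℝ) / p) ^ 2 := by
    have : 0 < (m : ℝ) / p := by positivity
    nlinarith
  have hc : 0 < c p m := by
    rw [c_eq_of_ne hp (by omega) (u := m / p) (by field_simp)]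
    positivity
  unfold commonFactor
  positivity

lemma F12_eq {p m l : ℕ} (hm : 0 < m) (hl : 0 < l) (h : m + l < p) (t : ℝ) :
    F12 p m (p + l) t = commonFactor p m l * mainKernel (l / p) ((m + l) / p) *
      Real.exp (-2 * ((m : ℝ) ^ 2 + ((p + l : ℕ) : ℝ) ^ 2 + (m : ℝ) * ((p + l : ℕ) : ℝ)) * t) := by
  have hp : 0 < p := by omega
  have hp' : (0 : ℝ) < p := by exact_mod_cast hp
  rw [F12, c_eq_of_ne hp (k := p + l) (by omega) (u := 1 + l / p) (by push_cast; field_simp),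
    d_eq_of_ne hp (k := m + (p + l)) (by omega) (by omega) (u := 1 + (m + l) / p)
      (by push_cast; field_simp; ring)]
  rw [commonFactor, mainKernel, show (1 + (l / p : ℝ)) * Real.pi = l / p * Real.pi + Real.pi by ring,
    show (1 + ((m + l) / p : ℝ)) * Real.pi = (m + l) / p * Real.pi + Real.pi by ring,
    Real.sin_add_pi, Real.sin_add_pi]
  generalize Real.sin _ = s₁
  generalize Real.sin _ = s₂
  congr 1
  generalize (l : ℝ) / p = y
  generalize ((m : ℝ) + l) / p = z
  rw [show 1 - (1 + y) ^ 2 = -(y * (2 + y)) by ring,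
    show 1 - (1 + z) ^ 2 = -(z * (2 + z)) by ring,
    show 4 - (1 + z) ^ 2 = (1 - z) * (3 + z) by ring]
  simp only [div_eq_mul_inv, mul_neg, neg_mul, inv_neg, neg_neg, mul_inv]
  ring

lemma F11_eq {p m l : ℕ} (hm : 0 < m) (hl : 0 < l) (h : m + l < p) (a : ℕ) (t : ℝ) :
    F11 p m ((a + 2) * p + l) t = -(commonFactor p m l *
      (dKernel ((a + 2 : ℕ) + (l / p : ℝ)) * cKernel ((a + 2 : ℕ) + ((m + l) / p : ℝ))) *
      Real.exp (-2 * ((m : ℝ) ^ 2 + (((a + 2) * p + l : ℕ) : ℝ) ^ 2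
        + (m : ℝ) * (((a + 2) * p + l : ℕ) : ℝ)) * t)) := by
  have hp : 0 < p := by omega
  have hp' : (0 : ℝ) < p := by exact_mod_cast hp
  have hge : 2 * p ≤ (a + 2) * p := by gcongr; omega
  rw [F11, c_eq_of_ne hp (k := m + ((a + 2) * p + l)) (by omega)
      (u := (a + 2 : ℕ) + (m + l) / p) (by push_cast; field_simp; ring),
    d_eq_of_ne hp (k := (a + 2) * p + l) (by omega) (by omega)
      (u := (a + 2 : ℕ) + l / p) (by push_cast; field_simp)]
  rw [commonFactor, dKernel, cKernel,
    show (((a + 2 : ℕ) : ℝ) + l / p) * Real.pi = l / p * Real.pi + (a + 2 : ℕ) * Real.pi by ring,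
    show (((a + 2 : ℕ) : ℝ) + (m + l) / p) * Real.pi
      = (m + l) / p * Real.pi + (a + 2 : ℕ) * Real.pi by ring,
    Real.sin_add_nat_mul_pi, Real.sin_add_nat_mul_pi, ← neg_mul]
  generalize Real.sin _ = s₁
  generalize Real.sin _ = s₂
  congr 1
  generalize ((a + 2 : ℕ) : ℝ) + (l : ℝ) / p = v
  generalize ((a + 2 : ℕ) : ℝ) + ((m : ℝ) + l) / p = w
  have hsq : ((-1 : ℝ) ^ (a + 2)) ^ 2 = 1 := by rw [← pow_mul, mul_comm, pow_mul]; simp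
  generalize (-1 : ℝ) ^ (a + 2) = e at hsq
  rw [show 1 - v ^ 2 = -(v ^ 2 - 1) by ring, show 4 - v ^ 2 = -(v ^ 2 - 4) by ring,
    show 1 - w ^ 2 = -(w ^ 2 - 1) by ring]
  simp only [div_eq_mul_inv, mul_neg, neg_mul, inv_neg, neg_neg, mul_inv]
  linear_combination (-12 * c p m * Real.pi⁻¹ ^ 2 * (p : ℝ)⁻¹ ^ 2 * s₁ * s₂ * v *
    (v ^ 2 - 1)⁻¹ * (v ^ 2 - 4)⁻¹ * w⁻¹ * (w ^ 2 - 1)⁻¹) * hsq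

lemma F12_pos {p m l : ℕ} (hm : 0 < m) (hl : 0 < l) (h : m + l < p) (t : ℝ) :
    0 < F12 p m (p + l) t := by
  have hp' : (0 : ℝ) < p := by exact_mod_cast (by omega : 0 < p)
  have hz : 0 < 1 - ((m : ℝ) + l) / p := by
    rw [sub_pos, div_lt_one hp']
    exact_mod_cast h
  have hl' : (0 : ℝ) < l := by exact_mod_cast hl
  have := commonFactor_pos hm hl h
  rw [F12_eq hm hl h, mainKernel]
  positivity

lemma F11_nonpos {p m l : ℕ} (hm : 0 < m) (hl : 0 < l) (h : m + l < p) (a : ℕ) (t : ℝ) :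
    F11 p m ((a + 2) * p + l) t ≤ 0 := by
  have hp' : (0 : ℝ) < p := by exact_mod_cast (by omega : 0 < p)
  have hl' : (0 : ℝ) < l := by exact_mod_cast hl
  have hy : 0 < (l : ℝ) / p := by positivity
  have hz : 0 < ((m : ℝ) + l) / p := by positivity
  have ha : (0 : ℝ) ≤ a := a.cast_nonneg
  have := commonFactor_pos hm hl h
  have := dKernel_nonneg (v := (a + 2 : ℕ) + (l / p : ℝ)) (by push_cast; linarith)
  have := cKernel_nonneg (w := (a + 2 : ℕ) + ((m + l) / p : ℝ)) (by push_cast; linarith)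
  rw [F11_eq hm hl h, neg_nonpos]
  positivity

lemma sum_neg_F11_le {p m l : ℕ} (hm : 0 < m) (hl : 0 < l) (h : m + l < p) {t : ℝ} (ht : 0 ≤ t)
    (n : ℕ) :
    ∑ a ∈ Finset.range n, -F11 p m ((a + 2) * p + l) t ≤ 11 / 200 * F12 p m (p + l) t := by
  have hp' : (0 : ℝ) < p := by exact_mod_cast (by omega : 0 < p)
  have hl' : (0 : ℝ) < l := by exact_mod_cast hl
  have hm' : (0 : ℝ) < m := by exact_mod_cast hm
  have hy : 0 < (l : ℝ) / p := by positivity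
  have hz : 0 < ((m : ℝ) + l) / p := by positivity
  have hyz : (l : ℝ) / p ≤ (m + l) / p := by gcongr; linarith
  have hz1 : ((m : ℝ) + l) / p < 1 := by
    rw [div_lt_one hp']
    exact_mod_cast h
  have hC := commonFactor_pos hm hl h
  set E := Real.exp
    (-2 * ((m : ℝ) ^ 2 + ((p + l : ℕ) : ℝ) ^ 2 + (m : ℝ) * ((p + l : ℕ) : ℝ)) * t) with hE
  have hterm : ∀ a ∈ Finset.range n, -F11 p m ((a + 2) * p + l) t ≤ commonFactor p m l * E *
      (dKernel ((a + 2 : ℕ) + (l / p : ℝ)) * cKernel ((a + 2 : ℕ) + ((m + l) / p : ℝ))) := by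
    intro a _
    have ha : (0 : ℝ) ≤ a := a.cast_nonneg
    have := dKernel_nonneg (v := (a + 2 : ℕ) + (l / p : ℝ)) (by push_cast; linarith)
    have := cKernel_nonneg (w := (a + 2 : ℕ) + ((m + l) / p : ℝ)) (by push_cast; linarith)
    have hle : ((p + l : ℕ) : ℝ) ≤ ((a + 2) * p + l : ℕ) := by
      have : p + l ≤ (a + 2) * p + l := by nlinarith [Nat.zero_le (a * p)]
      exact_mod_cast this
    rw [F11_eq hm hl h, neg_neg, mul_right_comm, hE]
    gcongr ?_ * Real.exp ?_ * ?_
    apply mul_le_mul_of_nonneg_right _ ht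
    apply mul_le_mul_of_nonpos_left _ (by norm_num)
    gcongr
  calc _ ≤ _ := Finset.sum_le_sum hterm
    _ = commonFactor p m l * E * ∑ a ∈ Finset.range n,
        dKernel ((a + 2 : ℕ) + (l / p : ℝ)) * cKernel ((a + 2 : ℕ) + ((m + l) / p : ℝ)) := by
      rw [Finset.mul_sum]
    _ ≤ commonFactor p m l * E * (11 / 200 * mainKernel (l / p) ((m + l) / p)) := by
      gcongr
      exact (sum_dKernel_mul_cKernel_le hy hz n).trans (kernel_bound hy hyz hz1)
    _ = 11 / 200 * F12 p m (p + l) t := by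
      rw [F12_eq hm hl h]
      ring

theorem J12_J11_compensation2 (p : ℕ) (hp : 3 ≤ p) (t : ℝ) (ht : 0 ≤ t) :
    0 < (3 / 50) * (∑ m ∈ Finset.Ico 1 p, ∑ l ∈ Finset.Ico 1 p,
          if m + l < p then F12 p m (p + l) t else 0)
      + ∑' a : ℕ, (∑ m ∈ Finset.Ico 1 p, ∑ l ∈ Finset.Ico 1 p,
          if m + l < p then F11 p m ((a + 2) * p + l) t else 0) := by
  set S := ∑ m ∈ Finset.Ico 1 p, ∑ l ∈ Finset.Ico 1 p,
    if m + l < p then F12 p m (p + l) t else 0 with hS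
  have hnonneg : ∀ m ∈ Finset.Ico 1 p, ∀ l ∈ Finset.Ico 1 p,
      0 ≤ if m + l < p then F12 p m (p + l) t else 0 := by
    intro m hm l hl
    rw [Finset.mem_Ico] at hm hl
    split_ifs with h
    · exact (F12_pos hm.1 hl.1 h t).le
    · exact le_rfl
  have hone : 1 ∈ Finset.Ico 1 p := Finset.mem_Ico.2 ⟨le_rfl, by omega⟩
  have hSpos : 0 < S := by
    refine Finset.sum_pos' (fun m hm => Finset.sum_nonneg (hnonneg m hm)) ⟨1, hone, ?_⟩
    refine Finset.sum_pos' (hnonneg 1 hone) ⟨1, hone, ?_⟩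
    rw [if_pos (by omega)]
    exact F12_pos one_pos one_pos (by omega) t
  have htail : ∑' a : ℕ, -(∑ m ∈ Finset.Ico 1 p, ∑ l ∈ Finset.Ico 1 p,
      if m + l < p then F11 p m ((a + 2) * p + l) t else 0) ≤ 11 / 200 * S := by
    refine Real.tsum_le_of_sum_range_le (fun a => ?_) (fun n => ?_)
    · refine neg_nonneg.2 (Finset.sum_nonpos fun m hm => Finset.sum_nonpos fun l hl => ?_)
      rw [Finset.mem_Ico] at hm hl
      split_ifs with h
      · exact F11_nonpos hm.1 hl.1 h a t
      · exact le_rfl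
    · simp only [← Finset.sum_neg_distrib]
      rw [Finset.sum_comm, hS, Finset.mul_sum]
      refine Finset.sum_le_sum fun m hm => ?_
      rw [Finset.sum_comm, Finset.mul_sum]
      refine Finset.sum_le_sum fun l hl => ?_
      rw [Finset.mem_Ico] at hm hl
      split_ifs with h
      · exact sum_neg_F11_le hm.1 hl.1 h ht n
      · simp
  rw [tsum_neg] at htail
  linarith
end

section
/- Let p ≥ 3 be a natural number and define F₁₁, F₁₂ as in the context. Then for every real t ≥ 0, ∑_{m,l ≥ 1, m+l < p} [ F₁₂(2p−m, p−l; t) + 2·F₁₁(2p−m, p−l; t) ] > 0, where the sum runs over pairs of positive integers (m,l) with m + l < p. -/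
lemma c_pos_of_lt {p k : ℕ} (hk : 0 < k) (hkp : k < p) : 0 < c p k := by
  have hk' : (0 : ℝ) < k := by exact_mod_cast hk
  have hkp' : (k : ℝ) < p := by exact_mod_cast hkp
  have hp : (0 : ℝ) < p := hk'.trans hkp'
  have hsin : 0 < Real.sin (Real.pi * k / p) := by
    apply Real.sin_pos_of_pos_of_lt_pi (by positivity)
    rw [div_lt_iff₀ hp]
    exact mul_lt_mul_of_pos_left hkp' Real.pi_pos
  have hsq : 0 < (p : ℝ) ^ 2 - (k : ℝ) ^ 2 := by nlinarith
  rw [c, if_neg hkp.ne]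
  positivity

lemma c_pos_of_lt_two_mul {p k : ℕ} (hpk : p < k) (hk : k < 2 * p) : 0 < c p k := by
  have hpk' : (p : ℝ) < k := by exact_mod_cast hpk
  have hk' : (k : ℝ) < 2 * p := by exact_mod_cast hk
  have hp : (0 : ℝ) < p := by linarith
  have hk0 : (0 : ℝ) < k := by linarith
  have hsin : 0 < Real.sin (Real.pi * k / p - Real.pi) := by
    apply Real.sin_pos_of_pos_of_lt_pi
    · rw [sub_pos, lt_div_iff₀ hp]
      exact mul_lt_mul_of_pos_left hpk' Real.pi_pos
    · rw [sub_lt_iff_lt_add, div_lt_iff₀ hp]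
      nlinarith [Real.pi_pos]
  rw [Real.sin_sub_pi] at hsin
  have hsq : (p : ℝ) ^ 2 - (k : ℝ) ^ 2 < 0 := by nlinarith
  rw [c, if_neg hpk.ne']
  apply div_pos_of_neg_of_neg
  · exact mul_neg_of_pos_of_neg (by positivity) (by linarith)
  · exact mul_neg_of_pos_of_neg (mul_pos Real.pi_pos hk0) hsq

lemma sin_pi_mul_div_pos {p k : ℕ} (hk : 2 * p < k) (hk' : k < 3 * p) :
    0 < Real.sin (Real.pi * k / p) := by
  have h2 : 2 * (p : ℝ) < k := by exact_mod_cast hk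
  have h3 : (k : ℝ) < 3 * p := by exact_mod_cast hk'
  have hp : (0 : ℝ) < p := by linarith
  rw [← Real.sin_sub_two_pi]
  apply Real.sin_pos_of_pos_of_lt_pi
  · rw [sub_pos, lt_div_iff₀ hp]
    nlinarith [Real.pi_pos]
  · rw [sub_lt_iff_lt_add, div_lt_iff₀ hp]
    nlinarith [Real.pi_pos]

lemma c_mul_d_add_pos {p b s : ℕ} (hb : 0 < b) (hbp : b < p) (hs : 2 * p < s) (hs' : s < 3 * p) :
    0 < c p b * d p s + 2 * (d p b * c p s) := by
  have hS := sin_pi_mul_div_pos hs hs'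
  have hc := c_pos_of_lt hb hbp
  have hb0 : (0 : ℝ) < b := by exact_mod_cast hb
  have hbp' : (b : ℝ) < p := by exact_mod_cast hbp
  have h2 : 2 * (p : ℝ) < s := by exact_mod_cast hs
  have hp : (0 : ℝ) < p := by linarith
  have hs0 : (0 : ℝ) < s := by linarith
  have h1 : 0 < (s : ℝ) ^ 2 - (p : ℝ) ^ 2 := by nlinarith
  have h3 : 0 < (s : ℝ) ^ 2 - 4 * (p : ℝ) ^ 2 := by nlinarith
  have h4 : 0 < (p : ℝ) ^ 2 - (b : ℝ) ^ 2 := by nlinarith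
  have h5 : 0 < 4 * (p : ℝ) ^ 2 - (b : ℝ) ^ 2 := by nlinarith
  have hnum : 0 < 4 * (p : ℝ) ^ 2 * (s : ℝ) ^ 2 - 3 * (b : ℝ) ^ 2 * (s : ℝ) ^ 2
      + 8 * (p : ℝ) ^ 2 * (b : ℝ) ^ 2 := by
    nlinarith [mul_pos (pow_pos hs0 2) h4, mul_pos (pow_pos hs0 2) (pow_pos hp 2),
      mul_pos (pow_pos hb0 2) (pow_pos hp 2)]
  have hd : d p b = c p b * (3 * (b : ℝ) ^ 2 / (4 * (p : ℝ) ^ 2 - (b : ℝ) ^ 2)) := by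
    rw [c, d, if_neg (by omega), if_neg (by omega)]
    field_simp
    ring
  have hds : d p s = 6 * (p : ℝ) ^ 2 * s * Real.sin (Real.pi * s / p) /
      (Real.pi * ((s : ℝ) ^ 2 - (p : ℝ) ^ 2) * ((s : ℝ) ^ 2 - 4 * (p : ℝ) ^ 2)) := by
    rw [d, if_neg (by omega)]
    congr 1
    ring
  have hcs : c p s = -(2 * (p : ℝ) ^ 2 * Real.sin (Real.pi * s / p) /
      (Real.pi * s * ((s : ℝ) ^ 2 - (p : ℝ) ^ 2))) := by
    rw [c, if_neg (by omega), ← div_neg]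
    congr 1
    ring
  have key : c p b * d p s + 2 * (d p b * c p s) =
      c p b * (6 * (p : ℝ) ^ 2 * Real.sin (Real.pi * s / p) *
        (4 * (p : ℝ) ^ 2 * (s : ℝ) ^ 2 - 3 * (b : ℝ) ^ 2 * (s : ℝ) ^ 2
          + 8 * (p : ℝ) ^ 2 * (b : ℝ) ^ 2) /
        (Real.pi * s * ((s : ℝ) ^ 2 - (p : ℝ) ^ 2) * ((s : ℝ) ^ 2 - 4 * (p : ℝ) ^ 2) *
          (4 * (p : ℝ) ^ 2 - (b : ℝ) ^ 2))) := by
    rw [hd, hds, hcs]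
    have h1' := h1.ne'
    have h3' := h3.ne'
    have h5' := h5.ne'
    generalize Real.sin (Real.pi * s / p) = S
    generalize hU : (s : ℝ) ^ 2 - 4 * (p : ℝ) ^ 2 = U at h3'
    generalize hV : 4 * (p : ℝ) ^ 2 - (b : ℝ) ^ 2 = V at h5'
    field_simp
    rw [← hU, ← hV]
    ring
  rw [key]
  positivity

lemma F12_add_two_mul_F11_pos {p a b : ℕ} (t : ℝ) (ha : p < a) (ha' : a < 2 * p)
    (hb : 0 < b) (hb' : b < p) (hab : 2 * p < a + b) :
    0 < F12 p a b t + 2 * F11 p a b t := by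
  have hfactor : F12 p a b t + 2 * F11 p a b t =
      c p a * (c p b * d p (a + b) + 2 * (d p b * c p (a + b))) *
        Real.exp (-2 * ((a : ℝ) ^ 2 + (b : ℝ) ^ 2 + (a : ℝ) * (b : ℝ)) * t) := by
    rw [F11, F12]
    ring
  rw [hfactor]
  exact mul_pos (mul_pos (c_pos_of_lt_two_mul ha ha')
    (c_mul_d_add_pos hb hb' hab (by omega))) (Real.exp_pos _)

theorem J12_plus_2J11_pos (p : ℕ) (hp : 3 ≤ p) (t : ℝ) (ht : 0 ≤ t) :
    0 < ∑ m ∈ Finset.Ico 1 p, ∑ l ∈ Finset.Ico 1 p,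
        if m + l < p then
          F12 p (2 * p - m) (p - l) t + 2 * F11 p (2 * p - m) (p - l) t
        else 0 := by
  have hterm : ∀ m ∈ Finset.Ico 1 p, ∀ l ∈ Finset.Ico 1 p, m + l < p →
      0 < F12 p (2 * p - m) (p - l) t + 2 * F11 p (2 * p - m) (p - l) t := by
    intro m hm l hl hml
    rw [Finset.mem_Ico] at hm hl
    apply F12_add_two_mul_F11_pos <;> omega
  have hnonneg : ∀ m ∈ Finset.Ico 1 p, ∀ l ∈ Finset.Ico 1 p,
      0 ≤ if m + l < p then
          F12 p (2 * p - m) (p - l) t + 2 * F11 p (2 * p - m) (p - l) t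
        else 0 := by
    intro m hm l hl
    split_ifs with h
    · exact (hterm m hm l hl h).le
    · exact le_rfl
  have h1 : 1 ∈ Finset.Ico 1 p := Finset.mem_Ico.2 ⟨le_rfl, by omega⟩
  refine Finset.sum_pos' (fun m hm => Finset.sum_nonneg (hnonneg m hm)) ⟨1, h1, ?_⟩
  refine Finset.sum_pos' (hnonneg 1 h1) ⟨1, h1, ?_⟩
  rw [if_pos (by omega)]
  exact hterm 1 h1 1 h1 (by omega)
end

section
/- Let p ≥ 3 be a natural number and define F₁₁ as in the context. Then for all integers a ≥ 1 and b ≥ 2 and all real t ≥ 0, ∑_{m,l ≥ 1, m+l < p} F₁₁(pa+m, pb+l; t) > | ∑_{1 ≤ m,l ≤ p−1, m+l > p} F₁₁(pa+m, pb+l; t) |, i.e. the (positive) sum over the lower triangle of the square strictly dominates the absolute value of the sum over the upper triangle. -/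
/-- The positive decreasing factor of `c p` at arguments `k > p`. -/
noncomputable def cAmp (p k : ℝ) : ℝ := 2 * p ^ 2 / (Real.pi * k * (k ^ 2 - p ^ 2))

/-- The positive decreasing factor of `d p` at arguments `k > 2 * p`. -/
noncomputable def dAmp (p k : ℝ) : ℝ :=
  6 * p ^ 2 * k / (Real.pi * (k ^ 2 - p ^ 2) * (k ^ 2 - 4 * p ^ 2))

lemma cAmp_pos {p k : ℝ} (hp : 0 < p) (hk : p < k) : 0 < cAmp p k := by
  have h : 0 < k ^ 2 - p ^ 2 := by nlinarith
  have := hp.trans hk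
  unfold cAmp
  positivity

lemma dAmp_pos {p k : ℝ} (hp : 0 < p) (hk : 2 * p < k) : 0 < dAmp p k := by
  have h : 0 < k ^ 2 - p ^ 2 := by nlinarith
  have h' : 0 < k ^ 2 - 4 * p ^ 2 := by nlinarith
  have : 0 < k := by linarith
  unfold dAmp
  positivity

lemma cAmp_lt_cAmp {p k k' : ℝ} (hp : 0 < p) (hk : p < k) (hkk : k < k') :
    cAmp p k' < cAmp p k := by
  have h : 0 < k ^ 2 - p ^ 2 := by nlinarith
  have hsq : k ^ 2 - p ^ 2 < k' ^ 2 - p ^ 2 := by nlinarith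
  have := hp.trans hk
  unfold cAmp
  gcongr

lemma dAmp_lt_dAmp {p k k' : ℝ} (hp : 0 < p) (hk : 2 * p < k) (hkk : k < k') :
    dAmp p k' < dAmp p k := by
  have h₀ : 0 < k := by linarith
  have h₀' : 0 < k' := by linarith
  have rewrite_amp : ∀ x : ℝ, 0 < x →
      dAmp p x = 6 * p ^ 2 / (Real.pi * (x - p ^ 2 / x) * (x ^ 2 - 4 * p ^ 2)) := by
    intro x hx
    unfold dAmp
    have : x - p ^ 2 / x = (x ^ 2 - p ^ 2) / x := by field_simp
    rw [this, mul_div_assoc', div_mul_eq_mul_div, div_div_eq_mul_div]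
  rw [rewrite_amp k h₀, rewrite_amp k' h₀']
  have h₁ : 0 < k - p ^ 2 / k := by
    rw [sub_pos, div_lt_iff₀ h₀]
    nlinarith
  have h₂ : 0 < k ^ 2 - 4 * p ^ 2 := by nlinarith
  have h₃ : k ^ 2 - 4 * p ^ 2 < k' ^ 2 - 4 * p ^ 2 := by nlinarith
  have h₄ : k - p ^ 2 / k < k' - p ^ 2 / k' := by
    have : p ^ 2 / k' < p ^ 2 / k := by gcongr
    linarith
  gcongr

lemma sin_pi_mul_add_div {p : ℕ} (hp : 0 < p) (a m : ℕ) :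
    Real.sin (Real.pi * ((p * a + m : ℕ) : ℝ) / p) =
      (-1) ^ a * Real.sin (Real.pi * m / p) := by
  have hp' : (p : ℝ) ≠ 0 := by positivity
  rw [← Real.sin_add_nat_mul_pi]
  congr 1
  push_cast
  field_simp
  ring

lemma c_mul_add {p a m : ℕ} (hp : 0 < p) (ha : 1 ≤ a) (hm : 1 ≤ m) :
    c p (p * a + m) =
      -((-1) ^ a * Real.sin (Real.pi * m / p) * cAmp p ((p * a + m : ℕ) : ℝ)) := by
  have hk : p < p * a + m := by nlinarith
  unfold c cAmp
  rw [if_neg hk.ne', sin_pi_mul_add_div hp, ← neg_sub (((p * a + m : ℕ) : ℝ) ^ 2), mul_neg,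
    div_neg]
  ring

lemma d_mul_add {p b l : ℕ} (hp : 0 < p) (hb : 2 ≤ b) (hl : 1 ≤ l) :
    d p (p * b + l) =
      (-1) ^ b * Real.sin (Real.pi * l / p) * dAmp p ((p * b + l : ℕ) : ℝ) := by
  have hk : 2 * p < p * b + l := by nlinarith
  unfold d dAmp
  rw [if_neg (by omega), sin_pi_mul_add_div hp, ← neg_sub (((p * b + l : ℕ) : ℝ) ^ 2),
    ← neg_sub (((p * b + l : ℕ) : ℝ) ^ 2) (4 * _), mul_neg, mul_neg,
    neg_mul, neg_neg]
  ring

/-- The symmetric trigonometric weight of `F11` on a square of side `p`. -/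
noncomputable def sinWeight (p m l : ℝ) : ℝ :=
  Real.sin (Real.pi * m / p) * Real.sin (Real.pi * l / p) * Real.sin (Real.pi * (m + l) / p)

/-- The positive decreasing factor of `F11`. -/
noncomputable def amp (p x y t : ℝ) : ℝ :=
  cAmp p x * dAmp p y * cAmp p (x + y) * Real.exp (-2 * (x ^ 2 + y ^ 2 + x * y) * t)

lemma F11_mul_add {p a b m l : ℕ} (hp : 0 < p) (ha : 1 ≤ a) (hb : 2 ≤ b) (hm : 1 ≤ m)
    (hl : 1 ≤ l) (t : ℝ) :
    F11 p (p * a + m) (p * b + l) t =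
      sinWeight p m l * amp p ((p * a + m : ℕ) : ℝ) ((p * b + l : ℕ) : ℝ) t := by
  have hsum : p * a + m + (p * b + l) = p * (a + b) + (m + l) := by ring
  have hsign : ((-1 : ℝ) ^ a * (-1) ^ b) * (-1) ^ (a + b) = 1 := by
    rw [← pow_add, ← mul_pow]
    norm_num
  unfold F11 sinWeight amp
  rw [c_mul_add hp ha hm, d_mul_add hp hb hl, ← Nat.cast_add (p * a + m), hsum,
    c_mul_add hp (by omega) (by omega), Nat.cast_add m l]
  linear_combination (Real.sin (Real.pi * m / p) * cAmp p ((p * a + m : ℕ) : ℝ) *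
    (Real.sin (Real.pi * l / p) * dAmp p ((p * b + l : ℕ) : ℝ)) *
    (Real.sin (Real.pi * (m + l) / p) * cAmp p ((p * (a + b) + (m + l) : ℕ) : ℝ)) *
    Real.exp (-2 * (((p * a + m : ℕ) : ℝ) ^ 2 + ((p * b + l : ℕ) : ℝ) ^ 2 +
      ((p * a + m : ℕ) : ℝ) * ((p * b + l : ℕ) : ℝ)) * t)) * hsign

lemma sinWeight_reflect {p : ℝ} (hp : p ≠ 0) (m l : ℝ) :
    sinWeight p (p - l) (p - m) = -sinWeight p m l := by
  have h₁ : ∀ x : ℝ, Real.sin (Real.pi * (p - x) / p) = Real.sin (Real.pi * x / p) := by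
    intro x
    rw [← Real.sin_pi_sub]
    congr 1
    field_simp
    ring
  have h₂ : Real.sin (Real.pi * (p - l + (p - m)) / p) = -Real.sin (Real.pi * (m + l) / p) := by
    rw [← Real.sin_two_pi_sub]
    congr 1
    field_simp
    ring
  unfold sinWeight
  rw [h₁, h₁, h₂]
  ring

lemma sinWeight_pos {p m l : ℝ} (hm : 0 < m) (hl : 0 < l) (h : m + l < p) :
    0 < sinWeight p m l := by
  have hp : 0 < p := by linarith
  have key : ∀ x : ℝ, 0 < x → x < p → 0 < Real.sin (Real.pi * x / p) := by
    intro x hx hxp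
    apply Real.sin_pos_of_pos_of_lt_pi (by positivity)
    rw [div_lt_iff₀ hp]
    exact mul_lt_mul_of_pos_left hxp Real.pi_pos
  exact mul_pos (mul_pos (key m hm (by linarith)) (key l hl (by linarith)))
    (key _ (by linarith) h)

lemma amp_pos {p x y : ℝ} (hp : 0 < p) (hx : p < x) (hy : 2 * p < y) (t : ℝ) :
    0 < amp p x y t :=
  mul_pos (mul_pos (mul_pos (cAmp_pos hp hx) (dAmp_pos hp hy))
    (cAmp_pos hp (by linarith))) (Real.exp_pos _)

lemma amp_lt_amp {p x y x' y' t : ℝ} (hp : 0 < p) (hx : p < x) (hy : 2 * p < y)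
    (hxx : x < x') (hyy : y < y') (ht : 0 ≤ t) : amp p x' y' t < amp p x y t := by
  have hexp : Real.exp (-2 * (x' ^ 2 + y' ^ 2 + x' * y') * t) ≤
      Real.exp (-2 * (x ^ 2 + y ^ 2 + x * y) * t) := by
    apply Real.exp_le_exp.2
    apply mul_le_mul_of_nonneg_right _ ht
    nlinarith
  have hc := cAmp_lt_cAmp hp hx hxx
  have hd := dAmp_lt_dAmp hp hy hyy
  have hs := cAmp_lt_cAmp hp (show p < x + y by linarith) (add_lt_add hxx hyy)
  have hc₀ := cAmp_pos hp (hx.trans hxx)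
  have hd₀ := dAmp_pos hp (hy.trans hyy)
  have hs₀ := cAmp_pos hp (show p < x' + y' by linarith)
  unfold amp
  refine mul_lt_mul (mul_lt_mul'' (mul_lt_mul'' hc hd hc₀.le hd₀.le) hs ?_ hs₀.le) hexp
    (Real.exp_pos _) ?_
  · positivity
  · exact (mul_pos (mul_pos (hc₀.trans hc) (hd₀.trans hd)) (hs₀.trans hs)).le

/-- Reflecting a point below the antidiagonal of the square across the antidiagonal strictly
decreases the absolute value of `F11`. -/
lemma abs_F11_reflect_lt {p a b m l : ℕ} (ha : 1 ≤ a) (hb : 2 ≤ b) (hm : 1 ≤ m) (hl : 1 ≤ l)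
    (hml : m + l < p) {t : ℝ} (ht : 0 ≤ t) :
    |F11 p (p * a + (p - l)) (p * b + (p - m)) t| < F11 p (p * a + m) (p * b + l) t := by
  have hp : 0 < p := by omega
  have hp' : (0 : ℝ) < p := by exact_mod_cast hp
  have hx : p < p * a + m := by nlinarith
  have hy : 2 * p < p * b + l := by nlinarith
  have hxx : p * a + m < p * a + (p - l) := by omega
  have hyy : p * b + l < p * b + (p - m) := by omega
  have hx' : (p : ℝ) < (p * a + m : ℕ) := by exact_mod_cast hx
  have hy' : 2 * (p : ℝ) < (p * b + l : ℕ) := by exact_mod_cast hy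
  have hxx' : ((p * a + m : ℕ) : ℝ) < (p * a + (p - l) : ℕ) := by exact_mod_cast hxx
  have hyy' : ((p * b + l : ℕ) : ℝ) < (p * b + (p - m) : ℕ) := by exact_mod_cast hyy
  have hw : 0 < sinWeight p m l :=
    sinWeight_pos (by exact_mod_cast hm) (by exact_mod_cast hl) (by exact_mod_cast hml)
  rw [F11_mul_add hp ha hb hm hl, F11_mul_add hp ha hb (by omega) (by omega),
    Nat.cast_sub (by omega : l ≤ p), Nat.cast_sub (by omega : m ≤ p),
    sinWeight_reflect hp'.ne', neg_mul, abs_neg,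
    abs_of_pos (mul_pos hw (amp_pos hp' (hx'.trans hxx') (hy'.trans hyy') t))]
  exact mul_lt_mul_of_pos_left (amp_lt_amp hp' hx' hy' hxx' hyy' ht) hw

lemma sum_Ico_one_reflect (p : ℕ) (f : ℕ → ℝ) :
    ∑ m ∈ Finset.Ico 1 p, f m = ∑ m ∈ Finset.Ico 1 p, f (p - m) := by
  refine Finset.sum_nbij' (fun m => p - m) (fun m => p - m) ?_ ?_ ?_ ?_ ?_ <;>
    intro m hm <;> rw [Finset.mem_Ico] at hm
  · exact Finset.mem_Ico.2 (by omega)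
  · exact Finset.mem_Ico.2 (by omega)
  · exact Nat.sub_sub_self (by omega)
  · exact Nat.sub_sub_self (by omega)
  · simp only [Nat.sub_sub_self hm.2.le]

lemma sum_upper_triangle_eq_sum_reflect (p : ℕ) (f : ℕ → ℕ → ℝ) :
    (∑ m ∈ Finset.Ico 1 p, ∑ l ∈ Finset.Ico 1 p, if p < m + l then f m l else 0) =
      ∑ m ∈ Finset.Ico 1 p, ∑ l ∈ Finset.Ico 1 p,
        if m + l < p then f (p - l) (p - m) else 0 := by
  rw [sum_Ico_one_reflect, Finset.sum_comm, sum_Ico_one_reflect]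
  refine Finset.sum_congr rfl fun m hm => Finset.sum_congr rfl fun l hl => ?_
  rw [Finset.mem_Ico] at hm hl
  exact if_congr (by omega) rfl rfl

theorem J11_lower_triangle_dominates (p : ℕ) (hp : 3 ≤ p)
    (a b : ℕ) (ha : 1 ≤ a) (hb : 2 ≤ b) (t : ℝ) (ht : 0 ≤ t) :
    |∑ m ∈ Finset.Ico 1 p, ∑ l ∈ Finset.Ico 1 p,
        if p < m + l then F11 p (p * a + m) (p * b + l) t else 0|
      < ∑ m ∈ Finset.Ico 1 p, ∑ l ∈ Finset.Ico 1 p,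
          if m + l < p then F11 p (p * a + m) (p * b + l) t else 0 := by
  have h_one : 1 ∈ Finset.Ico 1 p := Finset.mem_Ico.2 (by omega)
  have h_term : ∀ m ∈ Finset.Ico 1 p, ∀ l ∈ Finset.Ico 1 p,
      |if m + l < p then F11 p (p * a + (p - l)) (p * b + (p - m)) t else 0| ≤
        if m + l < p then F11 p (p * a + m) (p * b + l) t else 0 := by
    intro m hm l hl
    split_ifs with h
    · exact (abs_F11_reflect_lt ha hb (Finset.mem_Ico.1 hm).1 (Finset.mem_Ico.1 hl).1 h ht).le
    · exact abs_zero.le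
  rw [sum_upper_triangle_eq_sum_reflect p fun m l => F11 p (p * a + m) (p * b + l) t]
  refine (Finset.abs_sum_le_sum_abs _ _).trans_lt
    ((Finset.sum_le_sum fun m _ => Finset.abs_sum_le_sum_abs _ _).trans_lt ?_)
  refine Finset.sum_lt_sum (fun m hm => Finset.sum_le_sum (h_term m hm)) ⟨1, h_one, ?_⟩
  refine Finset.sum_lt_sum (h_term 1 h_one) ⟨1, h_one, ?_⟩
  rw [if_pos (by omega), if_pos (by omega)]
  exact abs_F11_reflect_lt ha hb le_rfl le_rfl (by omega) ht
end

section
/- Let p ≥ 3 be a natural number and define A, B as in the context. For positive integers k, l and real t set G(k,l;t) := ( 2·A(k)·A(k+l)·B(l) − A(k)·A(l)·B(k+l) )·exp(−(k²+l²+(k+l)²)t). Consider the set T of pairs of positive integers (k,l) satisfying at least one of the following: (a) k + l < p; (b) l > p and k + l < 2p; (c) k > p and k + l < 2p; (d) l > 2p and k + l < 3p; (e) k > 2p and k + l < 3p; (f) there is an integer a ≥ 3 with k < p, l < p(a+1) and k + l > p(a+1); (g) there is an integer a ≥ 3 with l < p, k < p(a+1) and k + l > p(a+1). Then for every real t ≥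 0, ∑_{(k,l) ∈ T} G(k,l;t) > (9·sin²(π/p)·sin(2π/p))/(8·p⁸) · e^{−6t}. -/
noncomputable def A (p k : ℕ) : ℝ :=
  if k = p then Real.pi / (2 * (p : ℝ)^2)
  else Real.sin (Real.pi * k / p) / ((p : ℝ)^2 - (k : ℝ)^2)

noncomputable def B (p k : ℕ) : ℝ :=
  if k = 2 * p then -(Real.pi / (2 * (p : ℝ)))
  else (k : ℝ) * Real.sin (Real.pi * k / p) / (4 * (p : ℝ)^2 - (k : ℝ)^2)

noncomputable def F1 (p k l : ℕ) (t : ℝ) : ℝ :=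
  A p k * A p (k + l) * B p l *
    Real.exp (-((k : ℝ)^2 + (l : ℝ)^2 + ((k : ℝ) + (l : ℝ))^2) * t)

noncomputable def F2 (p k l : ℕ) (t : ℝ) : ℝ :=
  -(A p k * A p l * B p (k + l)) *
    Real.exp (-((k : ℝ)^2 + (l : ℝ)^2 + ((k : ℝ) + (l : ℝ))^2) * t)

noncomputable def G (p k l : ℕ) (t : ℝ) : ℝ :=
  (2 * A p k * A p (k + l) * B p l - A p k * A p l * B p (k + l)) *
    Real.exp (-((k : ℝ)^2 + (l : ℝ)^2 + ((k : ℝ) + (l : ℝ))^2) * t)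

theorem neg_one_pow_mul_sin_pos {p x : ℝ} (hp : 0 < p) (n : ℕ) (h₁ : n * p < x)
    (h₂ : x < (n + 1) * p) : 0 < (-1) ^ n * Real.sin (Real.pi * x / p) := by
  have hpi := Real.pi_pos
  rw [← Real.sin_sub_nat_mul_pi]
  have e : Real.pi * x / p - n * Real.pi = Real.pi * ((x - n * p) / p) := by
    field_simp
  rw [e]
  have h0 : 0 < (x - n * p) / p := div_pos (by linarith) hp
  have h1 : (x - n * p) / p < 1 := by rw [div_lt_one hp]; linarith
  exact Real.sin_pos_of_pos_of_lt_pi (by positivity) (by nlinarith)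

/-- The factor `sin (π x / p) / ((p² - x²) (4 p² - x²))` common to `A p x` and `B p x`. -/
noncomputable def sineQuotient (p x : ℝ) : ℝ :=
  Real.sin (Real.pi * x / p) / ((p ^ 2 - x ^ 2) * (4 * p ^ 2 - x ^ 2))

theorem neg_one_pow_mul_sineQuotient_pos {p x : ℝ} (hp : 0 < p) (n : ℕ) (hn : 2 ≤ n)
    (h₁ : n * p < x) (h₂ : x < (n + 1) * p) : 0 < (-1) ^ n * sineQuotient p x := by
  have hs := neg_one_pow_mul_sin_pos hp n h₁ h₂
  have hn' : (2 : ℝ) ≤ n := by exact_mod_cast hn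
  have hx : 2 * p < x := by nlinarith
  rw [sineQuotient, ← mul_div_assoc]
  exact div_pos hs (mul_pos_of_neg_of_neg (by nlinarith) (by nlinarith))

theorem sineQuotient_pos_of_lt {p x : ℝ} (h₀ : 0 < x) (h : x < p) : 0 < sineQuotient p x := by
  have hs := neg_one_pow_mul_sin_pos (h₀.trans h) 0 (by simpa using h₀) (by simpa using h)
  exact div_pos (by simpa using hs) (mul_pos (by nlinarith) (by nlinarith))

theorem sineQuotient_pos_of_lt_two_mul {p x : ℝ} (hp : 0 < p) (h₁ : p < x) (h₂ : x < 2 * p) :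
    0 < sineQuotient p x := by
  have hs := neg_one_pow_mul_sin_pos hp 1 (by simpa using h₁) (by norm_num; exact h₂)
  exact div_pos_of_neg_of_neg (by simpa using hs)
    (mul_neg_of_neg_of_pos (by nlinarith) (by nlinarith))

theorem sineQuotient_pos_of_lt_three_mul {p x : ℝ} (hp : 0 < p) (h₁ : 2 * p < x)
    (h₂ : x < 3 * p) : 0 < sineQuotient p x := by
  simpa using neg_one_pow_mul_sineQuotient_pos hp 2 le_rfl (by simpa using h₁)
    (by norm_num; exact h₂)

theorem A_eq_sineQuotient {p k : ℕ} (h₁ : k ≠ p) (h₂ : k ≠ 2 * p) :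
    A p k = (4 * (p : ℝ) ^ 2 - (k : ℝ) ^ 2) * sineQuotient p k := by
  have h : 4 * (p : ℝ) ^ 2 - (k : ℝ) ^ 2 ≠ 0 := by
    intro h
    have h' : ((2 * p : ℕ) : ℝ) ^ 2 = (k : ℝ) ^ 2 := by push_cast; linarith
    exact h₂ (Nat.pow_left_injective (n := 2) two_ne_zero (by exact_mod_cast h'.symm))
  rw [A, if_neg h₁, sineQuotient, mul_comm ((p : ℝ) ^ 2 - (k : ℝ) ^ 2), ← mul_div_assoc,
    mul_div_mul_left _ _ h]

theorem B_eq_sineQuotient {p k : ℕ} (h₁ : k ≠ p) (h₂ : k ≠ 2 * p) :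
    B p k = k * ((p : ℝ) ^ 2 - (k : ℝ) ^ 2) * sineQuotient p k := by
  have h : (p : ℝ) ^ 2 - (k : ℝ) ^ 2 ≠ 0 := by
    intro h
    have h' : (p : ℝ) ^ 2 = (k : ℝ) ^ 2 := by linarith
    exact h₁ (Nat.pow_left_injective (n := 2) two_ne_zero (by exact_mod_cast h'.symm))
  rw [B, if_neg h₂, sineQuotient]
  rw [show (k : ℝ) * ((p : ℝ) ^ 2 - (k : ℝ) ^ 2) * (Real.sin (Real.pi * k / p) /
      (((p : ℝ) ^ 2 - (k : ℝ) ^ 2) * (4 * (p : ℝ) ^ 2 - (k : ℝ) ^ 2))) =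
      (((p : ℝ) ^ 2 - (k : ℝ) ^ 2) * (k * Real.sin (Real.pi * k / p))) /
      (((p : ℝ) ^ 2 - (k : ℝ) ^ 2) * (4 * (p : ℝ) ^ 2 - (k : ℝ) ^ 2)) by ring]
  rw [mul_div_mul_left _ _ h]

theorem G_add_G_swap {p k l : ℕ} (t : ℝ) (hk₁ : k ≠ p) (hk₂ : k ≠ 2 * p) (hl₁ : l ≠ p)
    (hl₂ : l ≠ 2 * p) (hz₁ : k + l ≠ p) (hz₂ : k + l ≠ 2 * p) :
    G p k l t + G p l k t =
      6 * (p : ℝ) ^ 2 * k * l * (k + l) *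
        ((12 * (p : ℝ) ^ 2 - ((k : ℝ) ^ 2 + k * l + (l : ℝ) ^ 2)) *
          (sineQuotient p k * sineQuotient p l * sineQuotient p (k + l))) *
        Real.exp (-((k : ℝ) ^ 2 + (l : ℝ) ^ 2 + ((k : ℝ) + (l : ℝ)) ^ 2) * t) := by
  rw [G, G, add_comm l k, add_comm (l : ℝ) (k : ℝ), add_comm ((l : ℝ) ^ 2) ((k : ℝ) ^ 2),
    A_eq_sineQuotient hk₁ hk₂, A_eq_sineQuotient hl₁ hl₂, A_eq_sineQuotient hz₁ hz₂,
    B_eq_sineQuotient hk₁ hk₂, B_eq_sineQuotient hl₁ hl₂, B_eq_sineQuotient hz₁ hz₂]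
  push_cast
  ring

/-- The set of index pairs over which the series in `J_triangle_part_lower_bound` runs. -/
def TrianglePair (p : ℕ) (x : ℕ × ℕ) : Prop :=
  1 ≤ x.1 ∧ 1 ≤ x.2 ∧
    (x.1 + x.2 < p ∨
     (p < x.2 ∧ x.1 + x.2 < 2 * p) ∨
     (p < x.1 ∧ x.1 + x.2 < 2 * p) ∨
     (2 * p < x.2 ∧ x.1 + x.2 < 3 * p) ∨
     (2 * p < x.1 ∧ x.1 + x.2 < 3 * p) ∨
     (∃ a : ℕ, 3 ≤ a ∧ x.1 < p ∧ x.2 < p * (a + 1) ∧ p * (a + 1) < x.1 + x.2) ∨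
     (∃ a : ℕ, 3 ≤ a ∧ x.2 < p ∧ x.1 < p * (a + 1) ∧ p * (a + 1) < x.1 + x.2))

theorem TrianglePair.swap {p : ℕ} {x : ℕ × ℕ} (h : TrianglePair p x) :
    TrianglePair p x.swap := by
  obtain ⟨k, l⟩ := x
  obtain ⟨hk, hl, h⟩ := h
  refine ⟨hl, hk, ?_⟩
  dsimp only [Prod.swap_prod_mk] at h ⊢
  rw [add_comm l k]
  rcases h with h | h | h | h | h | h | h
  exacts [.inl h, .inr (.inr (.inl h)), .inr (.inl h), .inr (.inr (.inr (.inr (.inl h)))),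
    .inr (.inr (.inr (.inl h))), .inr (.inr (.inr (.inr (.inr (.inr h))))),
    .inr (.inr (.inr (.inr (.inr (.inl h)))))]

theorem G_add_G_swap_nonneg_of_fst_lt {p k l : ℕ} (t : ℝ) (hk : 1 ≤ k) (hl : 1 ≤ l)
    (h : k + l < p ∨ (p < l ∧ k + l < 2 * p) ∨ (2 * p < l ∧ k + l < 3 * p) ∨
      ∃ a : ℕ, 3 ≤ a ∧ k < p ∧ l < p * (a + 1) ∧ p * (a + 1) < k + l) :
    0 ≤ G p k l t + G p l k t := by
  have hk' : (1 : ℝ) ≤ k := by exact_mod_cast hk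
  have hl' : (1 : ℝ) ≤ l := by exact_mod_cast hl
  suffices hs : (k ≠ p ∧ k ≠ 2 * p ∧ l ≠ p ∧ l ≠ 2 * p ∧ k + l ≠ p ∧ k + l ≠ 2 * p) ∧
      0 ≤ (12 * (p : ℝ) ^ 2 - ((k : ℝ) ^ 2 + k * l + (l : ℝ) ^ 2)) *
          (sineQuotient p k * sineQuotient p l * sineQuotient p (k + l)) by
    obtain ⟨⟨h1, h2, h3, h4, h5, h6⟩, hs⟩ := hs
    rw [G_add_G_swap t h1 h2 h3 h4 h5 h6]
    exact mul_nonneg (mul_nonneg (by positivity) hs) (Real.exp_pos _).le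
  rcases h with h | ⟨h₁, h₂⟩ | ⟨h₁, h₂⟩ | ⟨a, ha, h₁, h₂, h₃⟩
  · refine ⟨by omega, ?_⟩
    have h' : (k : ℝ) + l < p := by exact_mod_cast h
    have c1 := sineQuotient_pos_of_lt (p := p) (x := k) (by linarith) (by linarith)
    have c2 := sineQuotient_pos_of_lt (p := p) (x := l) (by linarith) (by linarith)
    have c3 := sineQuotient_pos_of_lt (p := p) (x := k + l) (by linarith) h'
    refine mul_nonneg ?_ (by positivity)
    nlinarith
  · refine ⟨by omega, ?_⟩
    have h₁' : (p : ℝ) < l := by exact_mod_cast h₁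
    have h₂' : (k : ℝ) + l < 2 * p := by exact_mod_cast h₂
    have hp : (0 : ℝ) < p := by linarith
    have c1 := sineQuotient_pos_of_lt (p := p) (x := k) (by linarith) (by linarith)
    have c2 := sineQuotient_pos_of_lt_two_mul hp h₁' (by linarith)
    have c3 := sineQuotient_pos_of_lt_two_mul (x := k + l) hp (by linarith) h₂'
    refine mul_nonneg ?_ (by positivity)
    nlinarith
  · refine ⟨by omega, ?_⟩
    have h₁' : 2 * (p : ℝ) < l := by exact_mod_cast h₁
    have h₂' : (k : ℝ) + l < 3 * p := by exact_mod_cast h₂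
    have hp : (0 : ℝ) < p := by linarith
    have c1 := sineQuotient_pos_of_lt (p := p) (x := k) (by linarith) (by linarith)
    have c2 := sineQuotient_pos_of_lt_three_mul hp h₁' (by linarith)
    have c3 := sineQuotient_pos_of_lt_three_mul (x := k + l) hp (by linarith) h₂'
    refine mul_nonneg ?_ (by positivity)
    nlinarith
  · have hpa : p * 3 ≤ p * a := Nat.mul_le_mul_left p ha
    rw [mul_add, mul_one] at h₂ h₃
    refine ⟨by omega, ?_⟩
    have h₁' : (k : ℝ) < p := by exact_mod_cast h₁
    have h₂' : (l : ℝ) < p * a + p := by exact_mod_cast h₂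
    have h₃' : (p * a + p : ℝ) < k + l := by exact_mod_cast h₃
    have hpa' : (p * 3 : ℝ) ≤ p * a := by exact_mod_cast hpa
    have hp : (0 : ℝ) < p := by linarith
    have c1 := sineQuotient_pos_of_lt (p := p) (x := k) (by linarith) h₁'
    have c2 := neg_one_pow_mul_sineQuotient_pos (x := l) hp a (by omega) (by linarith)
      (by linarith)
    have c3 := neg_one_pow_mul_sineQuotient_pos (x := k + l) hp (a + 1) (by omega)
      (by push_cast; linarith) (by push_cast; linarith)
    have hsq : ((-1 : ℝ) ^ a) * (-1) ^ a = 1 := by rw [← mul_pow]; simp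
    have c4 : sineQuotient p l * sineQuotient p (k + l) ≤ 0 := by
      have := mul_pos c2 c3
      rw [pow_succ, show ∀ e x y : ℝ, e * x * (e * -1 * y) = -(e * e * (x * y)) by
        intros; ring, hsq] at this
      linarith
    rw [mul_assoc (sineQuotient p k)]
    refine mul_nonneg_of_nonpos_of_nonpos ?_ (mul_nonpos_of_nonneg_of_nonpos c1.le c4)
    have hz : 4 * (p : ℝ) ≤ k + l := by linarith
    nlinarith [mul_nonneg (sub_nonneg.2 h₁'.le) (sub_nonneg.2 hz),
      mul_nonneg (sub_nonneg.2 hz) (sub_nonneg.2 hz), sq_nonneg ((p : ℝ) - k)]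

theorem TrianglePair.G_add_G_swap_nonneg {p : ℕ} {x : ℕ × ℕ} (hx : TrianglePair p x) (t : ℝ) :
    0 ≤ G p x.1 x.2 t + G p x.2 x.1 t := by
  obtain ⟨k, l⟩ := x
  obtain ⟨hk, hl, h⟩ := hx
  dsimp only at hk hl h ⊢
  rcases h with h | h | h | h | h | h | h
  · exact G_add_G_swap_nonneg_of_fst_lt t hk hl (.inl h)
  · exact G_add_G_swap_nonneg_of_fst_lt t hk hl (.inr (.inl h))
  · rw [add_comm k l] at h
    rw [add_comm]
    exact G_add_G_swap_nonneg_of_fst_lt t hl hk (.inr (.inl h))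
  · exact G_add_G_swap_nonneg_of_fst_lt t hk hl (.inr (.inr (.inl h)))
  · rw [add_comm k l] at h
    rw [add_comm]
    exact G_add_G_swap_nonneg_of_fst_lt t hl hk (.inr (.inr (.inl h)))
  · exact G_add_G_swap_nonneg_of_fst_lt t hk hl (.inr (.inr (.inr h)))
  · rw [add_comm k l] at h
    rw [add_comm]
    exact G_add_G_swap_nonneg_of_fst_lt t hl hk (.inr (.inr (.inr h)))

theorem Nat.cast_sq_le_mul_abs_sq_sub_sq {m k : ℕ} (h : k ≠ m) :
    (k : ℝ) ^ 2 ≤ ((m : ℝ) ^ 2 + 1) * |(m : ℝ) ^ 2 - (k : ℝ) ^ 2| := by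
  have h1 : (1 : ℝ) ≤ |(m : ℝ) ^ 2 - (k : ℝ) ^ 2| := by
    have h0 : (m : ℤ) ^ 2 - (k : ℤ) ^ 2 ≠ 0 := by
      intro h0
      exact h (Nat.pow_left_injective (n := 2) two_ne_zero
        (by exact_mod_cast (sub_eq_zero.1 h0).symm))
    exact_mod_cast Int.one_le_abs h0
  have h2 := neg_abs_le ((m : ℝ) ^ 2 - (k : ℝ) ^ 2)
  nlinarith [sq_nonneg (m : ℝ)]

theorem abs_A_le {p k : ℕ} (hk : 1 ≤ k) :
    |A p k| ≤ (4 * (p : ℝ) ^ 2 + 1) * (1 / (k : ℝ) ^ 2) := by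
  have hk' : (1 : ℝ) ≤ k := by exact_mod_cast hk
  rw [mul_one_div, A]
  split_ifs with h
  · subst h
    rw [abs_of_nonneg (by positivity), div_le_div_iff₀ (by positivity) (by positivity)]
    have := Real.pi_le_four
    nlinarith [mul_nonneg (sub_nonneg.2 this) (sq_nonneg (k : ℝ)),
      pow_nonneg (sq_nonneg (k : ℝ)) 2, mul_le_mul hk' hk' zero_le_one (by linarith)]
  · have h1 := Nat.cast_sq_le_mul_abs_sq_sub_sq h
    have h2 : 0 < |(p : ℝ) ^ 2 - (k : ℝ) ^ 2| := by
      by_contra! h3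
      nlinarith [sq_nonneg (p : ℝ)]
    rw [abs_div, div_le_div_iff₀ h2 (by positivity)]
    have h3 := Real.abs_sin_le_one (Real.pi * k / p)
    nlinarith [mul_le_mul_of_nonneg_right h3 (sq_nonneg (k : ℝ)),
      mul_nonneg (sq_nonneg (p : ℝ)) h2.le]

theorem abs_B_le {p k : ℕ} (hk : 1 ≤ k) : |B p k| ≤ 4 * (p : ℝ) ^ 2 + 1 := by
  have hk' : (1 : ℝ) ≤ k := by exact_mod_cast hk
  rw [B]
  split_ifs with h
  · have hp : (1 : ℝ) ≤ p := by exact_mod_cast (by omega : 1 ≤ p)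
    rw [abs_neg, abs_of_nonneg (by positivity), div_le_iff₀ (by positivity)]
    have := Real.pi_le_four
    nlinarith [pow_pos (by linarith : (0 : ℝ) < p) 3, mul_le_mul hp hp zero_le_one (by linarith)]
  · have h1 := Nat.cast_sq_le_mul_abs_sq_sub_sq h
    have e : ((2 * p : ℕ) : ℝ) ^ 2 = 4 * (p : ℝ) ^ 2 := by push_cast; ring
    rw [e] at h1
    have h2 : 0 < |4 * (p : ℝ) ^ 2 - (k : ℝ) ^ 2| := by
      by_contra! h3
      nlinarith [sq_nonneg (p : ℝ)]
    rw [abs_div, div_le_iff₀ h2, abs_mul, Nat.abs_cast]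
    have h3 := Real.abs_sin_le_one (Real.pi * k / p)
    nlinarith [mul_le_mul_of_nonneg_left h3 (by linarith : (0 : ℝ) ≤ k)]

theorem abs_G_le {p k l : ℕ} {t : ℝ} (ht : 0 ≤ t) (hk : 1 ≤ k) (hl : 1 ≤ l) :
    |G p k l t| ≤ 3 * (4 * (p : ℝ) ^ 2 + 1) ^ 3 * (1 / (k : ℝ) ^ 2 * (1 / (l : ℝ) ^ 2)) := by
  have hl' : (1 : ℝ) ≤ l := by exact_mod_cast hl
  have he : Real.exp (-((k : ℝ) ^ 2 + (l : ℝ) ^ 2 + ((k : ℝ) + (l : ℝ)) ^ 2) * t) ≤ 1 := by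
    rw [Real.exp_le_one_iff, neg_mul]
    exact neg_nonpos.2 (by positivity)
  have hA : |A p (k + l)| ≤ (4 * (p : ℝ) ^ 2 + 1) * (1 / (l : ℝ) ^ 2) := by
    refine (abs_A_le (by omega)).trans ?_
    push_cast
    gcongr
    linarith [(Nat.cast_nonneg k : (0 : ℝ) ≤ k)]
  rw [G, abs_mul, abs_of_pos (Real.exp_pos _)]
  refine (mul_le_of_le_one_right (abs_nonneg _) he).trans ((abs_sub _ _).trans ?_)
  rw [abs_mul, abs_mul, abs_mul, abs_mul, abs_mul, abs_two]
  calc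
    _ ≤ 2 * ((4 * (p : ℝ) ^ 2 + 1) * (1 / (k : ℝ) ^ 2)) *
          ((4 * (p : ℝ) ^ 2 + 1) * (1 / (l : ℝ) ^ 2)) * (4 * (p : ℝ) ^ 2 + 1) +
        ((4 * (p : ℝ) ^ 2 + 1) * (1 / (k : ℝ) ^ 2)) * ((4 * (p : ℝ) ^ 2 + 1) * (1 / (l : ℝ) ^ 2))
          * (4 * (p : ℝ) ^ 2 + 1) := by
      gcongr
      exacts [abs_A_le hk, abs_B_le hl, abs_A_le hk, abs_A_le hl, abs_B_le (by omega)]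
    _ = _ := by ring

theorem summable_G_trianglePair (p : ℕ) {t : ℝ} (ht : 0 ≤ t) :
    Summable fun x : {x : ℕ × ℕ // TrianglePair p x} => G p x.val.1 x.val.2 t := by
  have h1 : Summable fun n : ℕ => 1 / (n : ℝ) ^ 2 := Real.summable_one_div_nat_pow.2 one_lt_two
  have h2 : Summable fun x : ℕ × ℕ => 1 / (x.1 : ℝ) ^ 2 * (1 / (x.2 : ℝ) ^ 2) :=
    h1.mul_of_nonneg h1 (fun _ => by positivity) (fun _ => by positivity)
  refine Summable.of_norm_bounded
    ((h2.mul_left (3 * (4 * (p : ℝ) ^ 2 + 1) ^ 3)).comp_injective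
      (Subtype.val_injective (p := TrianglePair p))) fun x => ?_
  exact abs_G_le ht x.2.1 x.2.2.1

theorem lt_G_one_one {p : ℕ} (hp : 3 ≤ p) (t : ℝ) :
    (9 * Real.sin (Real.pi / p) ^ 2 * Real.sin (2 * Real.pi / p)) / (8 * (p : ℝ) ^ 8)
      * Real.exp (-6 * t) < G p 1 1 t := by
  have hp' : (3 : ℝ) ≤ p := by exact_mod_cast hp
  have hpi := Real.pi_pos
  have hs1 : 0 < Real.sin (Real.pi / p) :=
    Real.sin_pos_of_pos_of_lt_pi (by positivity) (by rw [div_lt_iff₀ (by linarith)]; nlinarith)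
  have hs2 : 0 < Real.sin (2 * Real.pi / p) :=
    Real.sin_pos_of_pos_of_lt_pi (by positivity) (by rw [div_lt_iff₀ (by linarith)]; nlinarith)
  have hq : (9 : ℝ) ≤ (p : ℝ) ^ 2 := by nlinarith
  have e8 : (p : ℝ) ^ 8 = ((p : ℝ) ^ 2) ^ 4 := by ring
  rw [G, A, A, B, B, if_neg (by omega), if_neg (by omega), if_neg (by omega), if_neg (by omega)]
  norm_num only [Nat.cast_one, Nat.cast_ofNat, mul_one, one_pow, one_mul]
  rw [mul_comm Real.pi 2, e8]
  refine mul_lt_mul_of_pos_right ?_ (Real.exp_pos _)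
  generalize (p : ℝ) ^ 2 = q at hq ⊢
  generalize Real.sin (Real.pi / p) = u at hs1 ⊢
  generalize Real.sin (2 * Real.pi / p) = v at hs2 ⊢
  have d1 : 0 < q - 1 := by linarith
  have d2 : 0 < q - 4 := by linarith
  have d3 : 0 < 4 * q - 1 := by linarith
  have key : 2 * (u / (q - 1)) * (v / (q - 4)) * (u / (4 * q - 1)) -
      u / (q - 1) * (u / (q - 1)) * (2 * v / (4 * q - 4)) =
      9 * u ^ 2 * v * (q / (2 * (q - 1) ^ 3 * ((q - 4) * (4 * q - 1)))) := by
    have n1 := d1.ne'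
    have n2 := d2.ne'
    have n3 := d3.ne'
    rw [show 4 * q - 4 = 4 * (q - 1) by ring]
    generalize hr : 4 * q - 1 = r at n3 ⊢
    field_simp
    rw [← hr]
    ring
  have hlt : (q - 1) ^ 3 * ((q - 4) * (4 * q - 1)) < q ^ 3 * (4 * q ^ 2) := by
    have h3 : (q - 1) ^ 3 < q ^ 3 := by gcongr; linarith
    exact mul_lt_mul'' h3 (by nlinarith) (by positivity) (by positivity)
  rw [key, ← mul_one_div (9 * u ^ 2 * v)]
  refine mul_lt_mul_of_pos_left ?_ (by positivity)
  rw [div_lt_div_iff₀ (by positivity) (by positivity)]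
  linarith

theorem J_triangle_part_lower_bound (p : ℕ) (hp : 3 ≤ p) (t : ℝ) (ht : 0 ≤ t) :
    (9 * Real.sin (Real.pi / p) ^ 2 * Real.sin (2 * Real.pi / p)) / (8 * (p : ℝ)^8)
        * Real.exp (-6 * t)
      < ∑' x : {x : ℕ × ℕ // 1 ≤ x.1 ∧ 1 ≤ x.2 ∧
            (x.1 + x.2 < p ∨
             (p < x.2 ∧ x.1 + x.2 < 2 * p) ∨
             (p < x.1 ∧ x.1 + x.2 < 2 * p) ∨
             (2 * p < x.2 ∧ x.1 + x.2 < 3 * p) ∨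
             (2 * p < x.1 ∧ x.1 + x.2 < 3 * p) ∨
             (∃ a : ℕ, 3 ≤ a ∧ x.1 < p ∧ x.2 < p * (a + 1) ∧ p * (a + 1) < x.1 + x.2) ∨
             (∃ a : ℕ, 3 ≤ a ∧ x.2 < p ∧ x.1 < p * (a + 1) ∧ p * (a + 1) < x.1 + x.2))},
          G p x.val.1 x.val.2 t := by
  change _ < ∑' x : {x : ℕ × ℕ // TrianglePair p x}, G p x.val.1 x.val.2 t
  have hsum := summable_G_trianglePair p ht
  let e : {x : ℕ × ℕ // TrianglePair p x} ≃ {x : ℕ × ℕ // TrianglePair p x} :=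
    (Equiv.prodComm ℕ ℕ).subtypeEquiv fun _ => ⟨TrianglePair.swap, TrianglePair.swap⟩
  have hswap := e.tsum_eq fun x => G p x.val.1 x.val.2 t
  have hsum' := e.summable_iff.2 hsum
  have hone : TrianglePair p (1, 1) := ⟨le_rfl, le_rfl, Or.inl (by omega)⟩
  have hle := (hsum.add hsum').le_tsum ⟨(1, 1), hone⟩
    fun x _ => x.2.G_add_G_swap_nonneg t
  rw [hsum.tsum_add hsum'] at hle
  change G p 1 1 t + G p 1 1 t ≤ _ + ∑' x, G p (e x).val.1 (e x).val.2 t at hle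
  linarith [lt_G_one_one hp t]
end
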